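/- Lemma 2 (insertion by swapping the minimum cycle edge): Let G be a finite simple graph with real edge weights w, let T be a maximum spanning forest of G, and let e = (u,v) be a new edge not in G with u ≠ v, u and v connected in G, and w(e) ≥ w(f) for every edge f of G. Let e_min be any edge of minimum weight on the unique path in T from u to v. Then the forest obtained from T by removing e_min and adding e is a maximum spanning forest of the graph G together with the edge e. -/

import Mathlib

/-- `F` is a spanning forest of `G`: a subgraph of `G` on all of `V` that is acyclic and
has the same connectivity relation as `G`. -/
def IsSpanningForest {V : Type*} (G F : SimpleGraph V) : Prop :=
  F ≤ G ∧ F.IsAcyclic ∧ ∀ u v : V, F.Reachable u v ↔ G.Reachable u v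

/-- Total weight of a graph: the sum of the weights of its edges. -/
noncomputable def forestWeight {V : Type*} [Fintype V] (w : Sym2 V → ℝ)
    (F : SimpleGraph V) : ℝ :=
  ∑ e ∈ (Set.toFinite F.edgeSet).toFinset, w e

/-- `T` is a maximum spanning forest of `G` with respect to the edge weights `w`. -/
def IsMaxSpanningForest {V : Type*} [Fintype V] (G : SimpleGraph V) (w : Sym2 V → ℝ)
    (T : SimpleGraph V) : Prop :=
  IsSpanningForest G T ∧
    ∀ F : SimpleGraph V, IsSpanningForest G F → forestWeight w F ≤ forestWeight w T

/-- Two vertices joined by a walk which become separated when the edge `s(x, y)` is deleted are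
separated by it: one of them stays connected to `x` and the other one to `y`. -/
theorem SimpleGraph.Reachable.deleteEdges_singleton_cases {V : Type*} {F : SimpleGraph V}
    {a b : V} (x y : V) (h : F.Reachable a b) :
    (F.deleteEdges {s(x, y)}).Reachable a b ∨
      ((F.deleteEdges {s(x, y)}).Reachable a x ∧ (F.deleteEdges {s(x, y)}).Reachable y b) ∨
      ((F.deleteEdges {s(x, y)}).Reachable a y ∧ (F.deleteEdges {s(x, y)}).Reachable x b) := by
  obtain ⟨p⟩ := h
  induction p with
  | nil => exact .inl .rfl
  | @cons a c b hac _ ih =>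
    by_cases hs : s(a, c) = s(x, y)
    · have hrefl := fun z : V => SimpleGraph.Reachable.refl (G := F.deleteEdges {s(x, y)}) z
      rcases Sym2.eq_iff.1 hs with ⟨rfl, rfl⟩ | ⟨rfl, rfl⟩ <;> grind
    · have hadj : (F.deleteEdges {s(x, y)}).Adj a c := by simp [hac, hs]
      rcases ih with h | ⟨h, h'⟩ | ⟨h, h'⟩
      · exact .inl (hadj.reachable.trans h)
      · exact .inr (.inl ⟨hadj.reachable.trans h, h'⟩)
      · exact .inr (.inr ⟨hadj.reachable.trans h, h'⟩)

/-- If every edge of `F` joins vertices reachable in `H`, then so does every walk of `F`. -/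
theorem SimpleGraph.Reachable.of_forall_adj {V : Type*} {F H : SimpleGraph V} {a b : V}
    (hFH : ∀ ⦃c d⦄, F.Adj c d → H.Reachable c d) (h : F.Reachable a b) : H.Reachable a b := by
  obtain ⟨p⟩ := h
  induction p with
  | nil => exact .rfl
  | cons hac _ ih => exact (hFH hac).trans ih

/-- Exchanging the edge `s(x, y)` for an edge `s(a, b)` between the two parts into which its
deletion splits a component preserves reachability. -/
theorem SimpleGraph.reachable_deleteEdges_sup_edge_iff {V : Type*} {F : SimpleGraph V}
    {x y a b : V} (hxy : F.Adj x y) (hab : F.Reachable a b)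
    (hsep : ¬ (F.deleteEdges {s(x, y)}).Reachable a b) (c d : V) :
    (F.deleteEdges {s(x, y)} ⊔ SimpleGraph.edge a b).Reachable c d ↔ F.Reachable c d := by
  have hne : a ≠ b := by rintro rfl; exact hsep .rfl
  have hle : F.deleteEdges {s(x, y)} ≤ F.deleteEdges {s(x, y)} ⊔ SimpleGraph.edge a b := le_sup_left
  have hab' : (F.deleteEdges {s(x, y)} ⊔ SimpleGraph.edge a b).Reachable a b :=
    SimpleGraph.Adj.reachable (by simp [SimpleGraph.edge_adj, hne])
  constructor
  · refine fun h => h.of_forall_adj fun c d hcd => ?_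
    rw [SimpleGraph.sup_adj, SimpleGraph.edge_adj] at hcd
    rcases hcd with hcd | ⟨⟨rfl, rfl⟩ | ⟨rfl, rfl⟩, -⟩
    · exact (SimpleGraph.deleteEdges_le _ hcd).reachable
    · exact hab
    · exact hab.symm
  · have hxy' : (F.deleteEdges {s(x, y)} ⊔ SimpleGraph.edge a b).Reachable x y := by
      rcases hab.deleteEdges_singleton_cases x y with h | ⟨h, h'⟩ | ⟨h, h'⟩
      · exact absurd h hsep
      · exact ((h.mono hle).symm.trans hab').trans (h'.mono hle).symm
      · exact ((h'.mono hle).trans hab'.symm).trans (h.mono hle)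
    refine fun h => h.of_forall_adj fun c d hcd => ?_
    by_cases hs : s(c, d) = s(x, y)
    · rcases Sym2.eq_iff.1 hs with ⟨rfl, rfl⟩ | ⟨rfl, rfl⟩
      exacts [hxy', hxy'.symm]
    · exact SimpleGraph.Adj.reachable (hle (by simp [hcd, hs]))

theorem SimpleGraph.IsAcyclic.deleteEdges_sup_edge {V : Type*} {F : SimpleGraph V}
    (hF : F.IsAcyclic) {s : Set (Sym2 V)} {a b : V}
    (hsep : ¬ (F.deleteEdges s).Reachable a b) :
    (F.deleteEdges s ⊔ SimpleGraph.edge a b).IsAcyclic :=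
  (hF.anti (SimpleGraph.deleteEdges_le _)).sup_edge_of_not_reachable hsep

theorem forestWeight_deleteEdges_sup_edge {V : Type*} [Fintype V] (w : Sym2 V → ℝ)
    {F : SimpleGraph V} {x y a b : V} (hxy : F.Adj x y)
    (hsep : ¬ (F.deleteEdges {s(x, y)}).Reachable a b) :
    forestWeight w (F.deleteEdges {s(x, y)} ⊔ SimpleGraph.edge a b) =
      forestWeight w F - w s(x, y) + w s(a, b) := by
  classical
  have hne : a ≠ b := by rintro rfl; exact hsep .rfl
  have hnot : s(a, b) ∉ (F.deleteEdges {s(x, y)}).edgeSet := fun h =>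
    hsep (SimpleGraph.Adj.reachable h)
  have hset : (Set.toFinite (F.deleteEdges {s(x, y)} ⊔ SimpleGraph.edge a b).edgeSet).toFinset =
      insert s(a, b) ((Set.toFinite F.edgeSet).toFinset.erase s(x, y)) := by
    ext e
    simp [SimpleGraph.edgeSet_sup, SimpleGraph.edgeSet_edge_of_ne hne, and_comm]
  have hnot' : s(a, b) ∉ (Set.toFinite F.edgeSet).toFinset.erase s(x, y) := by
    simpa [and_comm] using hnot
  have hmem : s(x, y) ∈ (Set.toFinite F.edgeSet).toFinset := by simpa using hxy
  rw [forestWeight, forestWeight, hset, Finset.sum_insert hnot', ← Finset.sum_erase_add _ _ hmem]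
  ring

/-- Deleting an edge of a path in an acyclic graph separates the endpoints of the path. -/
theorem SimpleGraph.IsAcyclic.not_reachable_deleteEdges_of_mem_edges {V : Type*}
    {T : SimpleGraph V} (hT : T.IsAcyclic) {u v : V} {p : T.Walk u v} (hp : p.IsPath)
    {e : Sym2 V} (he : e ∈ p.edges) : ¬ (T.deleteEdges {e}).Reachable u v := by
  classical
  intro h
  obtain ⟨q, hq⟩ := h.exists_isPath
  have heq := (hT.subsingleton_path u v).elim ⟨p, hp⟩
    ⟨q.mapLe (SimpleGraph.deleteEdges_le _), hq.mapLe _⟩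
  have hpq : p = q.mapLe (SimpleGraph.deleteEdges_le _) := congrArg Subtype.val heq
  rw [hpq, SimpleGraph.Walk.edges_mapLe_eq_edges] at he
  simpa using q.edges_subset_edgeSet he

/-- A walk between vertices not reachable from each other in `H` has an edge whose endpoints are
not reachable from each other in `H`. -/
theorem SimpleGraph.Walk.exists_mem_edges_not_reachable {V : Type*} {G H : SimpleGraph V}
    {u v : V} (p : G.Walk u v) (h : ¬ H.Reachable u v) :
    ∃ a b, s(a, b) ∈ p.edges ∧ ¬ H.Reachable a b := by
  induction p with
  | nil => exact absurd .rfl h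
  | @cons u c v _ _ ih =>
    by_cases huc : H.Reachable u c
    · obtain ⟨a, b, hab, hnot⟩ := ih fun hcv => h (huc.trans hcv)
      exact ⟨a, b, by simp [hab], hnot⟩
    · exact ⟨u, c, by simp, huc⟩

/-- Lemma 2: inserting a heaviest new edge `e = s(u,v)` (endpoints already connected in `G`)
and removing a minimum-weight edge `e_min` on the unique `T`-path from `u` to `v` yields a
maximum spanning forest of `G` together with `e`. -/
theorem stmt_3 {V : Type*} [Fintype V] (G : SimpleGraph V) (w : Sym2 V → ℝ)
    (T : SimpleGraph V) (hT : IsMaxSpanningForest G w T)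
    (u v : V) (huv : u ≠ v) (hnew : ¬ G.Adj u v) (hconn : G.Reachable u v)
    (hw : ∀ f ∈ G.edgeSet, w f ≤ w s(u, v))
    (p : T.Walk u v) (hp : p.IsPath)
    (emin : Sym2 V) (hmem : emin ∈ p.edges) (hmin : ∀ f ∈ p.edges, w emin ≤ w f) :
    IsMaxSpanningForest (G ⊔ SimpleGraph.edge u v) w
      ((T.deleteEdges {emin}) ⊔ SimpleGraph.edge u v) := by
  obtain ⟨⟨hTG, hTac, hTr⟩, hTmax⟩ := hT
  induction emin with | _ x y
  have hxy : T.Adj x y := p.edges_subset_edgeSet hmem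
  have hsep := hTac.not_reachable_deleteEdges_of_mem_edges hp hmem
  have hGr (c d : V) : (G ⊔ SimpleGraph.edge u v).Reachable c d ↔ G.Reachable c d := by
    refine ⟨fun h => h.of_forall_adj fun c d hcd => ?_, fun h => h.mono le_sup_left⟩
    rw [SimpleGraph.sup_adj, SimpleGraph.edge_adj] at hcd
    rcases hcd with hcd | ⟨⟨rfl, rfl⟩ | ⟨rfl, rfl⟩, -⟩
    exacts [hcd.reachable, hconn, hconn.symm]
  refine ⟨⟨sup_le_sup_right ((SimpleGraph.deleteEdges_le _).trans hTG) _,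
    hTac.deleteEdges_sup_edge hsep, fun c d => ?_⟩, fun F ⟨hFG, hFac, hFr⟩ => ?_⟩
  · rw [SimpleGraph.reachable_deleteEdges_sup_edge_iff hxy ⟨p⟩ hsep, hTr, hGr]
  rw [forestWeight_deleteEdges_sup_edge w hxy hsep]
  have hdel : F.deleteEdges {s(u, v)} ≤ G := by
    intro c d hcd
    rw [SimpleGraph.deleteEdges_adj] at hcd
    have := hFG hcd.1
    rw [SimpleGraph.sup_adj, SimpleGraph.edge_adj] at this
    rcases this with h | ⟨h, -⟩
    · exact h
    · exact absurd (Sym2.eq_iff.2 h) hcd.2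
  by_cases huvF : F.Adj u v
  · have hFsep := hFac.not_reachable_deleteEdges_of_mem_edges (p := huvF.toWalk)
      (by simp [huv]) (e := s(u, v)) (by simp)
    obtain ⟨a, b, hab, hnot⟩ := p.exists_mem_edges_not_reachable hFsep
    have hGab : G.Adj a b := hTG (p.edges_subset_edgeSet hab)
    have hFab : F.Reachable a b := by rw [hFr, hGr]; exact hGab.reachable
    have hF' := hTmax (F.deleteEdges {s(u, v)} ⊔ SimpleGraph.edge a b)
      ⟨sup_le hdel (by simpa [SimpleGraph.edge_le_iff] using .inr hGab),
        hFac.deleteEdges_sup_edge hnot, fun c d => by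
          rw [SimpleGraph.reachable_deleteEdges_sup_edge_iff huvF hFab hnot, hFr, hGr]⟩
    rw [forestWeight_deleteEdges_sup_edge w huvF hnot] at hF'
    linarith [hmin _ hab]
  · rw [SimpleGraph.deleteEdges_eq_self.2 (by simpa using huvF)] at hdel
    have hF' := hTmax F ⟨hdel, hFac, fun c d => by rw [hFr, hGr]⟩
    linarith [hw s(x, y) (hTG hxy)]
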